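/- arXiv:2506.08133 — 2 statements merged into one kernel-verified Lean document; each statement's English description precedes it below -/
import Mathlib

section
/- (Numerical form of Theorem 1.3 via a Boij–Söderberg decomposition.) Fix integers 1 ≤ c ≤ p, r ≥ 0, and i ≥ 0. Suppose B : ℕ → ℚ is a function such that there exist finitely many degree sequences d^1, …, d^s and positive rational numbers c_1, …, c_s where: each d^j has first entry 0, has some length t_j with c ≤ t_j ≤ p, and has last entry at most t_j + r; and for every index i' one has B(i') = Σ_{j=1}^s c_j · β_{i'}(π_{d^j}) (where β_{i'}(π_{d^j}) is taken to be 0 when i' exceeds t_j). Then binom(c,i) · c^(−r) ≤ B(i)/B(0) ≤ binom(p,i) · p^r. -/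
/-- The `i`-th total Betti number of the pure diagram `π_d` associated to a degree
sequence `d = (d 0, d 1, …, d N)` of length `N` (with `d 0 = 0`):
`β_i(π_d) = (∏_{j=1}^N d_j) / (∏_{j ≠ i} |d_i − d_j|)`. -/
noncomputable def pureBetti (N : ℕ) (d : ℕ → ℤ) (i : ℕ) : ℚ :=
  (∏ j ∈ Finset.Icc 1 N, (d j : ℚ)) /
    ∏ j ∈ (Finset.range (N + 1)).erase i, |(d i : ℚ) - (d j : ℚ)|

open Finset in
theorem prod_add_div_eq_choose (m e : ℕ) :
    ∏ k ∈ range m, ((k : ℚ) + 1 + e) / ((k : ℚ) + 1) = ((m + e).choose m : ℚ) := by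
  induction m with
  | zero => simp
  | succ m ih =>
    rw [prod_range_succ, ih]
    have h := Nat.add_one_mul_choose_eq (m + e) m
    have h' : ((m : ℚ) + e + 1) * ((m + e).choose m : ℚ) =
        ((m + 1 + e).choose (m + 1) : ℚ) * (m + 1) := by
      rw [show m + 1 + e = m + e + 1 by ring]
      exact_mod_cast h
    field_simp
    linear_combination h'

theorem choose_add_le_pow (m e : ℕ) : (m + e).choose m ≤ (m + 1) ^ e := by
  induction e with
  | zero => simp
  | succ e ih =>
    have h := Nat.choose_mul_succ_eq (m + e) m
    rw [show m + e + 1 - m = e + 1 by omega] at h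
    have h2 : (m + e + 1).choose m * (e + 1) ≤ (m + 1) ^ (e + 1) * (e + 1) := by
      rw [← h, pow_succ, mul_assoc]
      exact Nat.mul_le_mul ih (by nlinarith)
    exact Nat.le_of_mul_le_mul_right h2 (by omega)

theorem choose_mul_choose_le (m n e : ℕ) :
    (m + e).choose m * (n + (m + 1 + e)).choose n ≤
      (m + 1 + n).choose (m + 1) * (m + 1 + n) ^ e := by
  induction e with
  | zero =>
    have : (n + (m + 1)).choose n = (m + 1 + n).choose (m + 1) := by
      rw [add_comm n, Nat.choose_symm_add]
    simp [this]
  | succ e ih =>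
    have h1 := Nat.choose_mul_succ_eq (m + e) m
    rw [show m + e + 1 - m = e + 1 by omega] at h1
    have h2 := Nat.choose_mul_succ_eq (n + (m + 1 + e)) n
    rw [show n + (m + 1 + e) + 1 - n = m + e + 2 by omega] at h2
    have key : (m + e + 1) * (n + (m + 1 + e) + 1) ≤ (m + 1 + n) * ((e + 1) * (m + e + 2)) :=
      calc (m + e + 1) * (n + (m + 1 + e) + 1) ≤ (m + 1 + n + e) * (m + e + 2) := by nlinarith
        _ ≤ ((m + 1 + n) * (e + 1)) * (m + e + 2) := by
          gcongr
          nlinarith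
        _ = _ := by ring
    have h3 : ((m + e + 1).choose m * (n + (m + 1 + e) + 1).choose n) * ((e + 1) * (m + e + 2)) ≤
        ((m + 1 + n).choose (m + 1) * (m + 1 + n) ^ (e + 1)) * ((e + 1) * (m + e + 2)) :=
      calc _ = ((m + e + 1).choose m * (e + 1)) *
              ((n + (m + 1 + e) + 1).choose n * (m + e + 2)) := by ring
        _ = ((m + e).choose m * (n + (m + 1 + e)).choose n) *
              ((m + e + 1) * (n + (m + 1 + e) + 1)) := by rw [← h1, ← h2]; ring
        _ ≤ _ := Nat.mul_le_mul ih key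
        _ = _ := by ring
    exact Nat.le_of_mul_le_mul_right h3 (by positivity)

theorem add_le_of_lt_succ {N : ℕ} {d : ℕ → ℤ} (hd : ∀ k < N, d k < d (k + 1)) (j n : ℕ)
    (h : j + n ≤ N) : d j + n ≤ d (j + n) := by
  induction n with
  | zero => simp
  | succ n ih =>
    have h1 := ih (by omega)
    have h2 := hd (j + n) (by omega)
    rw [← add_assoc j n 1]
    push_cast
    omega

open Finset in
theorem pureBetti_zero {N : ℕ} {d : ℕ → ℤ} (h0 : d 0 = 0)
    (hd : ∀ k < N, d k < d (k + 1)) : pureBetti N d 0 = 1 := by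
  have hpos : ∀ j ∈ Icc 1 N, (0 : ℚ) < d j := fun j hj => by
    rw [mem_Icc] at hj
    have h := add_le_of_lt_succ hd 0 j (by omega)
    rw [zero_add, h0] at h
    exact_mod_cast (show 0 < d j by omega)
  have hset : (range (N + 1)).erase 0 = Icc 1 N := by
    ext j
    simp only [mem_erase, mem_range, mem_Icc]
    omega
  have hden : ∏ j ∈ Icc 1 N, |(d 0 : ℚ) - d j| = ∏ j ∈ Icc 1 N, (d j : ℚ) :=
    prod_congr rfl fun j hj => by rw [h0, Int.cast_zero, zero_sub, abs_neg, abs_of_pos (hpos j hj)]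
  rw [pureBetti, hset, hden, div_self (prod_pos hpos).ne']

open Finset in
theorem pureBetti_succ {m n : ℕ} {d : ℕ → ℤ} (h0 : d 0 = 0)
    (hd : ∀ k < m + 1 + n, d k < d (k + 1)) :
    pureBetti (m + 1 + n) d (m + 1) =
      (∏ k ∈ range m, (d (k + 1) : ℚ) / ((d (m + 1) : ℚ) - d (k + 1))) *
      ∏ k ∈ range n, (d (m + 1 + (k + 1)) : ℚ) / ((d (m + 1 + (k + 1)) : ℚ) - d (m + 1)) := by
  have hpos : (0 : ℚ) < d (m + 1) := by
    have h := add_le_of_lt_succ hd 0 (m + 1) (by omega)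
    rw [zero_add, h0] at h
    exact_mod_cast (show 0 < d (m + 1) by omega)
  have hset : (range (m + 1 + n + 1)).erase (m + 1) =
      range (m + 1) ∪ Ico (m + 2) (m + 1 + n + 1) := by
    ext j
    simp only [mem_erase, mem_range, mem_union, mem_Ico]
    omega
  have hdisj : Disjoint (range (m + 1)) (Ico (m + 2) (m + 1 + n + 1)) := by
    rw [disjoint_left]
    intro j
    simp only [mem_range, mem_Ico]
    omega
  have hnum : ∏ j ∈ Icc 1 (m + 1 + n), (d j : ℚ) =
      ((∏ k ∈ range m, (d (k + 1) : ℚ)) * d (m + 1)) *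
        ∏ k ∈ range n, (d (m + 1 + (k + 1)) : ℚ) := by
    have : Icc 1 (m + 1 + n) = Ico 1 (m + 1 + n + 1) := by
      ext j
      simp only [mem_Icc, mem_Ico]
      omega
    rw [this, prod_Ico_eq_prod_range, Nat.add_sub_cancel, prod_range_add, prod_range_succ]
    congr 1
    · simp only [add_comm 1]
    · exact prod_congr rfl fun k _ => by rw [show 1 + (m + 1 + k) = m + 1 + (k + 1) by ring]
  have hlow : ∏ j ∈ range (m + 1), |(d (m + 1) : ℚ) - d j| =
      (∏ k ∈ range m, ((d (m + 1) : ℚ) - d (k + 1))) * d (m + 1) := by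
    rw [prod_range_succ', h0, Int.cast_zero, sub_zero, abs_of_pos hpos]
    congr 1
    refine prod_congr rfl fun k hk => abs_of_nonneg ?_
    rw [mem_range] at hk
    have h := add_le_of_lt_succ hd (k + 1) (m - k) (by omega)
    rw [show k + 1 + (m - k) = m + 1 by omega] at h
    rw [sub_nonneg]
    exact_mod_cast (show d (k + 1) ≤ d (m + 1) by omega)
  have hhigh : ∏ j ∈ Ico (m + 2) (m + 1 + n + 1), |(d (m + 1) : ℚ) - d j| =
      ∏ k ∈ range n, ((d (m + 1 + (k + 1)) : ℚ) - d (m + 1)) := by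
    rw [prod_Ico_eq_prod_range, show m + 1 + n + 1 - (m + 2) = n by omega]
    refine prod_congr rfl fun k hk => ?_
    rw [mem_range] at hk
    have h := add_le_of_lt_succ hd (m + 1) (k + 1) (by omega)
    rw [show m + 2 + k = m + 1 + (k + 1) by ring, abs_sub_comm, abs_of_nonneg]
    rw [sub_nonneg]
    exact_mod_cast (show d (m + 1) ≤ d (m + 1 + (k + 1)) by omega)
  rw [pureBetti, hset, prod_union hdisj, hnum, hlow, hhigh, prod_div_distrib, prod_div_distrib,
    mul_div_mul_comm, mul_div_mul_right _ _ hpos.ne']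

open Finset in
theorem pureBetti_succ_le {m n r : ℕ} {d : ℕ → ℤ} (h0 : d 0 = 0)
    (hd : ∀ k < m + 1 + n, d k < d (k + 1)) (hr : d (m + 1 + n) ≤ (m + 1 + n : ℕ) + (r : ℤ)) :
    pureBetti (m + 1 + n) d (m + 1) ≤
      ((m + 1 + n).choose (m + 1) : ℚ) * ((m + 1 + n : ℕ) : ℚ) ^ r := by
  have hlo := add_le_of_lt_succ hd 0 (m + 1) (by omega)
  have hhi := add_le_of_lt_succ hd (m + 1) n le_rfl
  rw [zero_add, h0] at hlo
  obtain ⟨e, he⟩ : ∃ e : ℕ, d (m + 1) = (m + 1 : ℕ) + (e : ℤ) :=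
    ⟨(d (m + 1) - (m + 1 : ℕ)).toNat, by omega⟩
  have her : e ≤ r := by push_cast at *; omega
  have hheq : (d (m + 1) : ℚ) = m + 1 + e := by rw [he]; push_cast; ring
  have hA : ∏ k ∈ range m, (d (k + 1) : ℚ) / ((d (m + 1) : ℚ) - d (k + 1)) ≤
      ((m + e).choose m : ℚ) := by
    rw [← prod_add_div_eq_choose, prod_div_distrib (f := fun k : ℕ => (k : ℚ) + 1 + e),
      ← prod_range_reflect (fun k : ℕ => (k : ℚ) + 1), ← prod_div_distrib]
    have hk (k : ℕ) (hk : k ∈ range m) : (0 : ℚ) < d (k + 1) ∧ (d (k + 1) : ℚ) ≤ k + 1 + e ∧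
        ((m - 1 - k : ℕ) : ℚ) + 1 = m - k ∧ (0 : ℚ) < m - k := by
      rw [mem_range] at hk
      have h1 := add_le_of_lt_succ hd 0 (k + 1) (by omega)
      have h2 := add_le_of_lt_succ hd (k + 1) (m - k) (by omega)
      rw [show k + 1 + (m - k) = m + 1 by omega, he] at h2
      rw [zero_add, h0] at h1
      refine ⟨by exact_mod_cast (show 0 < d (k + 1) by omega),
        by exact_mod_cast (show d (k + 1) ≤ k + 1 + e by push_cast at *; omega), ?_, ?_⟩
      · rw [Nat.sub_sub, Nat.cast_sub (by omega)]
        push_cast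
        ring
      · rw [sub_pos]
        exact_mod_cast hk
    refine prod_le_prod (fun k hkm => ?_) fun k hkm => ?_ <;>
      obtain ⟨h1, h2, h3, h4⟩ := hk k hkm
    · exact div_nonneg h1.le (by rw [hheq]; linarith)
    · rw [h3, hheq]
      exact div_le_div₀ (by linarith) h2 h4 (by linarith)
  have hB : ∏ k ∈ range n, (d (m + 1 + (k + 1)) : ℚ) / ((d (m + 1 + (k + 1)) : ℚ) - d (m + 1)) ≤
      ((n + (m + 1 + e)).choose n : ℚ) := by
    rw [← prod_add_div_eq_choose]
    have hk (k : ℕ) (hk : k ∈ range n) : (d (m + 1) : ℚ) + (k + 1) ≤ d (m + 1 + (k + 1)) := by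
      rw [mem_range] at hk
      exact_mod_cast add_le_of_lt_succ hd (m + 1) (k + 1) (by omega)
    refine prod_le_prod (fun k hkm => ?_) fun k hkm => ?_ <;>
      have h1 := hk k hkm <;> rw [hheq] at h1 ⊢
    · exact div_nonneg (by linarith [show (0 : ℚ) ≤ m + 1 + e + (k + 1) by positivity])
        (by linarith [show (0 : ℚ) ≤ k by positivity])
    · rw [div_le_div_iff₀ (by linarith [show (0 : ℚ) ≤ k by positivity]) (by positivity)]
      push_cast
      nlinarith [mul_nonneg (show (0 : ℚ) ≤ m + 1 + e by positivity) (sub_nonneg.2 h1)]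
  have hB0 : 0 ≤ ∏ k ∈ range n,
      (d (m + 1 + (k + 1)) : ℚ) / ((d (m + 1 + (k + 1)) : ℚ) - d (m + 1)) := by
    refine prod_nonneg fun k hk => ?_
    rw [mem_range] at hk
    have h1 := add_le_of_lt_succ hd (m + 1) (k + 1) (by omega)
    refine div_nonneg ?_ (sub_nonneg.2 ?_)
    · exact_mod_cast (show 0 ≤ d (m + 1 + (k + 1)) by omega)
    · exact_mod_cast (show d (m + 1) ≤ d (m + 1 + (k + 1)) by omega)
  calc pureBetti (m + 1 + n) d (m + 1)
      ≤ ((m + e).choose m : ℚ) * ((n + (m + 1 + e)).choose n : ℚ) := by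
        rw [pureBetti_succ h0 hd]
        exact mul_le_mul hA hB hB0 (by positivity)
    _ ≤ ((m + 1 + n).choose (m + 1) : ℚ) * ((m + 1 + n : ℕ) : ℚ) ^ e := by
        exact_mod_cast choose_mul_choose_le m n e
    _ ≤ _ := by
        gcongr
        exact_mod_cast (show 1 ≤ m + 1 + n by omega)

open Finset in
theorem le_pureBetti_succ {m n r : ℕ} {d : ℕ → ℤ} (h0 : d 0 = 0)
    (hd : ∀ k < m + 1 + n, d k < d (k + 1)) (hr : d (m + 1 + n) ≤ (m + 1 + n : ℕ) + (r : ℤ)) :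
    ((m + 1 + n).choose (m + 1) : ℚ) / ((m + 1 + n : ℕ) : ℚ) ^ r ≤
      pureBetti (m + 1 + n) d (m + 1) := by
  have hlo := add_le_of_lt_succ hd 0 (m + 1) (by omega)
  have hhi := add_le_of_lt_succ hd (m + 1) n le_rfl
  rw [zero_add, h0] at hlo
  obtain ⟨e, he⟩ : ∃ e : ℕ, d (m + 1) = (m + 1 : ℕ) + (e : ℤ) :=
    ⟨(d (m + 1) - (m + 1 : ℕ)).toNat, by omega⟩
  obtain ⟨f, rfl⟩ : ∃ f, r = e + f := Nat.exists_eq_add_of_le (by push_cast at *; omega)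
  have hheq : (d (m + 1) : ℚ) = m + 1 + e := by rw [he]; push_cast; ring
  have hA : ((m + e).choose m : ℚ)⁻¹ ≤
      ∏ k ∈ range m, (d (k + 1) : ℚ) / ((d (m + 1) : ℚ) - d (k + 1)) := by
    rw [← prod_add_div_eq_choose, prod_div_distrib (s := range m), inv_div,
      ← prod_range_reflect (fun k : ℕ => (k : ℚ) + 1 + e), ← prod_div_distrib]
    refine prod_le_prod (fun k _ => by positivity) fun k hk => ?_
    rw [mem_range] at hk
    have h1 := add_le_of_lt_succ hd 0 (k + 1) (by omega)
    have h2 := add_le_of_lt_succ hd (k + 1) (m - k) (by omega)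
    rw [show k + 1 + (m - k) = m + 1 by omega] at h2
    rw [zero_add, h0] at h1
    have h3 : (k : ℚ) + 1 ≤ d (k + 1) := by
      exact_mod_cast (show (k : ℤ) + 1 ≤ d (k + 1) by push_cast at *; omega)
    have h4 : (0 : ℚ) < d (m + 1) - d (k + 1) := by
      rw [sub_pos]
      exact_mod_cast (show d (k + 1) < d (m + 1) by omega)
    have h5 : ((m - 1 - k : ℕ) : ℚ) + 1 = m - k := by
      rw [Nat.sub_sub, Nat.cast_sub (by omega)]
      push_cast
      ring
    rw [h5]
    exact div_le_div₀ (by linarith [show (0 : ℚ) ≤ k by positivity]) h3 h4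
      (by rw [hheq]; linarith)
  have hB : ((m + 1 + n).choose (m + 1) : ℚ) * ((n + f).choose n : ℚ)⁻¹ ≤
      ∏ k ∈ range n, (d (m + 1 + (k + 1)) : ℚ) / ((d (m + 1 + (k + 1)) : ℚ) - d (m + 1)) := by
    rw [show (m + 1 + n).choose (m + 1) = (n + (m + 1)).choose n by
        rw [add_comm n, Nat.choose_symm_add], ← prod_add_div_eq_choose, ← prod_add_div_eq_choose,
      ← prod_inv_distrib, ← prod_mul_distrib]
    refine prod_le_prod (fun k _ => by positivity) fun k hk => ?_
    rw [mem_range] at hk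
    have h1 := add_le_of_lt_succ hd (m + 1) (k + 1) (by omega)
    have h2 := add_le_of_lt_succ hd (m + 1 + (k + 1)) (n - (k + 1)) (by omega)
    rw [show m + 1 + (k + 1) + (n - (k + 1)) = m + 1 + n by omega] at h2
    have h3 : (d (m + 1) : ℚ) + (k + 1) ≤ d (m + 1 + (k + 1)) := by exact_mod_cast h1
    have h4 : (d (m + 1 + (k + 1)) : ℚ) ≤ d (m + 1) + (k + 1 + f) := by
      exact_mod_cast (show d (m + 1 + (k + 1)) ≤ d (m + 1) + (k + 1 + f) by
        push_cast at *; omega)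
    rw [inv_div, div_mul_div_cancel₀ (by positivity),
      div_le_div_iff₀ (by positivity) (by linarith [show (0 : ℚ) ≤ k by positivity])]
    rw [hheq] at h3 h4 ⊢
    push_cast
    have he0 : (0 : ℚ) ≤ e := by positivity
    have hm0 : (0 : ℚ) ≤ m := by positivity
    have hk0 : (0 : ℚ) ≤ k := by positivity
    have hf0 : (0 : ℚ) ≤ f := by positivity
    nlinarith [mul_nonneg (show (0 : ℚ) ≤ m + 1 by positivity) (sub_nonneg.2 h4),
      mul_nonneg he0 hf0, mul_nonneg he0 hk0]
  have hcm : ((m + e).choose m : ℚ) ≤ ((m + 1 + n : ℕ) : ℚ) ^ e := by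
    exact_mod_cast (choose_add_le_pow m e).trans (Nat.pow_le_pow_left (by omega) e)
  have hcn : ((n + f).choose n : ℚ) ≤ ((m + 1 + n : ℕ) : ℚ) ^ f := by
    exact_mod_cast (choose_add_le_pow n f).trans (Nat.pow_le_pow_left (by omega) f)
  have hcm0 : (0 : ℚ) < (m + e).choose m := by exact_mod_cast Nat.choose_pos (by omega)
  have hcn0 : (0 : ℚ) < (n + f).choose n := by exact_mod_cast Nat.choose_pos (by omega)
  calc ((m + 1 + n).choose (m + 1) : ℚ) / ((m + 1 + n : ℕ) : ℚ) ^ (e + f)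
      ≤ ((m + 1 + n).choose (m + 1) : ℚ) / (((m + e).choose m : ℚ) * ((n + f).choose n : ℚ)) := by
        rw [pow_add]
        gcongr
    _ = ((m + e).choose m : ℚ)⁻¹ *
          (((m + 1 + n).choose (m + 1) : ℚ) * ((n + f).choose n : ℚ)⁻¹) := by
        field_simp
    _ ≤ _ := by
        rw [pureBetti_succ h0 hd]
        exact mul_le_mul hA hB (by positivity) ((inv_nonneg.2 hcm0.le).trans hA)

open Finset in
theorem pureBetti_succ_le_add {m n l : ℕ} {d : ℕ → ℤ} (h0 : d 0 = 0)
    (hd : ∀ k < m + 1 + (n + l), d k < d (k + 1)) :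
    pureBetti (m + 1 + n) d (m + 1) ≤ pureBetti (m + 1 + (n + l)) d (m + 1) := by
  have hd' : ∀ k < m + 1 + n, d k < d (k + 1) := fun k hk => hd k (by omega)
  have hm := add_le_of_lt_succ hd 0 (m + 1) (by omega)
  rw [zero_add, h0] at hm
  have hnonneg : 0 ≤ pureBetti (m + 1 + n) d (m + 1) := by
    refine div_nonneg (prod_nonneg fun j hj => ?_) (prod_nonneg fun j _ => abs_nonneg _)
    rw [mem_Icc] at hj
    have h := add_le_of_lt_succ hd' 0 j (by omega)
    rw [zero_add, h0] at h
    exact_mod_cast (show 0 ≤ d j by omega)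
  rw [pureBetti_succ h0 hd] at *
  rw [pureBetti_succ h0 hd'] at *
  rw [prod_range_add, ← mul_assoc]
  refine le_mul_of_one_le_right hnonneg ?_
  refine Finset.one_le_prod fun k hk => ?_
  rw [mem_range] at hk
  have h := add_le_of_lt_succ hd (m + 1) (n + k + 1) (by omega)
  have h1 : (0 : ℚ) ≤ d (m + 1) := by exact_mod_cast (show 0 ≤ d (m + 1) by omega)
  have h2 : (0 : ℚ) < (d (m + 1 + (n + k + 1)) : ℚ) - d (m + 1) := by
    rw [sub_pos]
    exact_mod_cast (show d (m + 1) < d (m + 1 + (n + k + 1)) by omega)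
  rw [le_div_iff₀ h2]
  linarith

theorem pureBetti_le {N r i : ℕ} {d : ℕ → ℤ} (hN : 1 ≤ N) (hi : i ≤ N) (h0 : d 0 = 0)
    (hd : ∀ k < N, d k < d (k + 1)) (hr : d N ≤ (N : ℤ) + r) :
    pureBetti N d i ≤ (N.choose i : ℚ) * (N : ℚ) ^ r := by
  cases i with
  | zero =>
    rw [pureBetti_zero h0 hd, Nat.choose_zero_right, Nat.cast_one, one_mul]
    exact one_le_pow₀ (by exact_mod_cast hN)
  | succ m =>
    obtain ⟨n, rfl⟩ := Nat.exists_eq_add_of_le hi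
    exact pureBetti_succ_le h0 hd hr

theorem le_pureBetti {c N r i : ℕ} {d : ℕ → ℤ} (hc : 1 ≤ c) (hcN : c ≤ N) (hi : i ≤ c)
    (h0 : d 0 = 0) (hd : ∀ k < N, d k < d (k + 1)) (hr : d N ≤ (N : ℤ) + r) :
    (c.choose i : ℚ) / (c : ℚ) ^ r ≤ pureBetti N d i := by
  cases i with
  | zero =>
    rw [pureBetti_zero h0 hd, Nat.choose_zero_right, Nat.cast_one]
    exact div_le_one_of_le₀ (one_le_pow₀ (by exact_mod_cast hc)) (by positivity)
  | succ m =>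
    obtain ⟨n, rfl⟩ := Nat.exists_eq_add_of_le hi
    obtain ⟨l, rfl⟩ := Nat.exists_eq_add_of_le hcN
    have h := add_le_of_lt_succ hd (m + 1 + n) l le_rfl
    refine (le_pureBetti_succ h0 (fun k hk => hd k (by omega)) (r := r)
      (by push_cast at *; omega)).trans ?_
    rw [add_assoc (m + 1) n l] at hd ⊢
    exact pureBetti_succ_le_add h0 hd

/-- numerical form of Theorem 1.3 via a Boij–Söderberg decomposition:
if `B` is a positive rational combination of pure diagrams of degree sequences,
each of length between `c` and `p`, starting at `0`, with last entry at most
length + `r`, then `binom(c,i) · c^(−r) ≤ B(i)/B(0) ≤ binom(p,i) · p^r`. -/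
theorem algebraicBounds (c p r i : ℕ) (hc : 1 ≤ c) (hcp : c ≤ p)
    (B : ℕ → ℚ)
    (h : ∃ (s : ℕ) (_ : 0 < s) (t : Fin s → ℕ) (d : Fin s → ℕ → ℤ) (coef : Fin s → ℚ),
      (∀ j, 0 < coef j) ∧
      (∀ j, c ≤ t j ∧ t j ≤ p) ∧
      (∀ j, d j 0 = 0) ∧
      (∀ j, ∀ k < t j, d j k < d j (k + 1)) ∧
      (∀ j, d j (t j) ≤ (t j : ℤ) + r) ∧
      (∀ i', B i' = ∑ j, coef j * (if i' ≤ t j then pureBetti (t j) (d j) i' else 0))) :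
    (c.choose i : ℚ) * (c : ℚ) ^ (-(r : ℤ)) ≤ B i / B 0 ∧
      B i / B 0 ≤ (p.choose i : ℚ) * (p : ℚ) ^ r := by
  obtain ⟨s, hs, t, d, coef, hcoef, ht, h0, hd, hr, hB⟩ := h
  have hB0 : B 0 = ∑ j, coef j := by
    rw [hB]
    refine Finset.sum_congr rfl fun j _ => ?_
    rw [if_pos (Nat.zero_le _), pureBetti_zero (h0 j) (hd j), mul_one]
  have hpos : 0 < B 0 := by
    rw [hB0]
    exact Finset.sum_pos (fun j _ => hcoef j) ⟨⟨0, hs⟩, Finset.mem_univ _⟩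
  rw [le_div_iff₀ hpos, div_le_iff₀ hpos, hB0, hB i, Finset.mul_sum, Finset.mul_sum]
  refine ⟨Finset.sum_le_sum fun j _ => ?_, Finset.sum_le_sum fun j _ => ?_⟩
  · rw [mul_comm]
    refine mul_le_mul_of_nonneg_left ?_ (hcoef j).le
    rw [zpow_neg, zpow_natCast, ← div_eq_mul_inv]
    by_cases hi : i ≤ c
    · rw [if_pos (hi.trans (ht j).1)]
      exact le_pureBetti hc (ht j).1 hi (h0 j) (hd j) (hr j)
    · rw [Nat.choose_eq_zero_of_lt (not_le.1 hi), Nat.cast_zero, zero_div]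
      split_ifs with hit
      · exact le_trans (by positivity)
          (le_pureBetti (hc.trans (ht j).1) le_rfl hit (h0 j) (hd j) (hr j))
      · exact le_rfl
  · rw [mul_comm _ (coef j)]
    refine mul_le_mul_of_nonneg_left ?_ (hcoef j).le
    split_ifs with hit
    · refine (pureBetti_le (hc.trans (ht j).1) hit (h0 j) (hd j) (hr j)).trans ?_
      have h1 : ((t j).choose i : ℚ) ≤ p.choose i := by
        exact_mod_cast Nat.choose_le_choose i (ht j).2
      have h2 : (t j : ℚ) ≤ p := by exact_mod_cast (ht j).2
      gcongr
    · positivity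
end

section
/- Fix integers N ≥ 1, r ≥ 1, and 0 ≤ i ≤ N, and suppose i ≥ 1. Let d be a degree sequence with d_0 = 0, d_N ≤ N + r, and set a = d_i − i, so 0 ≤ a ≤ r. Then β_i(π_d) ≥ binom(N,i) · i^(−a) · (N−i+1)^(−(r−a)) as rational numbers (with the convention that when i = N the factor (N−i+1)^(−(r−a)) equals 1^(−(r−a)) = 1). -/
/-- The product form of the bound `(m + s).choose s ≤ (m + 1) ^ s`. -/
theorem prod_range_add_le_factorial_mul_pow (m s : ℕ) :
    ∏ k ∈ Finset.range m, ((k : ℚ) + 1 + s) ≤ (m.factorial : ℚ) * ((m : ℚ) + 1) ^ s := by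
  induction m with
  | zero => simp
  | succ m ih =>
    have hm : (0 : ℚ) < (m : ℚ) + 1 := by positivity
    have key : ((m : ℚ) + 1) ^ s * ((m : ℚ) + 1 + s) ≤ ((m : ℚ) + 1) * ((m : ℚ) + 1 + 1) ^ s := by
      clear ih
      induction s with
      | zero => simp
      | succ s ih =>
        have h := mul_le_mul_of_nonneg_right ih (by positivity : (0 : ℚ) ≤ (m : ℚ) + 1 + 1)
        have h2 : (0 : ℚ) ≤ ((m : ℚ) + 1) ^ s * s := by positivity
        push_cast
        simp only [pow_succ]
        nlinarith
    rw [Finset.prod_range_succ, Nat.factorial_succ]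
    push_cast
    calc _ ≤ (m.factorial : ℚ) * ((m : ℚ) + 1) ^ s * ((m : ℚ) + 1 + s) := by gcongr
      _ = (m.factorial : ℚ) * (((m : ℚ) + 1) ^ s * ((m : ℚ) + 1 + s)) := by ring
      _ ≤ (m.factorial : ℚ) * (((m : ℚ) + 1) * ((m : ℚ) + 1 + 1) ^ s) := by gcongr
      _ = _ := by ring

/-- The gaps of a degree sequence are at least the gaps of the indices. -/
theorem sub_le_sub_of_lt_succ {N : ℕ} {d : ℕ → ℤ} (hmono : ∀ j < N, d j < d (j + 1))
    {j k : ℕ} (hjk : j ≤ k) (hk : k ≤ N) : (k : ℤ) - j ≤ d k - d j := by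
  induction k, hjk using Nat.le_induction with
  | base => simp
  | succ k _ ih =>
    have := hmono k (by omega)
    have := ih (by omega)
    push_cast
    omega

/-- The pure Betti number with the factor `d i` cancelled and the denominators split according to
the position of the index relative to `i = p + 1`. -/
theorem pureBetti_eq_mul {p m : ℕ} {d : ℕ → ℤ} (hmono : ∀ j < p + 1 + m, d j < d (j + 1))
    (h0 : d 0 = 0) :
    pureBetti (p + 1 + m) d (p + 1) =
      ((∏ j ∈ Finset.range p, (d (j + 1) : ℚ)) /
        ∏ j ∈ Finset.range p, ((d (p + 1) : ℚ) - d (j + 1))) *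
      ((∏ k ∈ Finset.range m, (d (p + 1 + (k + 1)) : ℚ)) /
        ∏ k ∈ Finset.range m, ((d (p + 1 + (k + 1)) : ℚ) - d (p + 1))) := by
  have hd : (0 : ℚ) < d (p + 1) := by
    have := sub_le_sub_of_lt_succ hmono (Nat.zero_le (p + 1)) (by omega)
    have : 0 < d (p + 1) := by push_cast at this; omega
    exact_mod_cast this
  have hnum : ∏ j ∈ Finset.Icc 1 (p + 1 + m), (d j : ℚ) =
      (∏ j ∈ Finset.range p, (d (j + 1) : ℚ)) * d (p + 1) *
        ∏ k ∈ Finset.range m, (d (p + 1 + (k + 1)) : ℚ) := by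
    rw [← Finset.Ico_add_one_right_eq_Icc, Finset.prod_Ico_eq_prod_range, Nat.add_sub_cancel,
      Finset.prod_range_add, Finset.prod_range_succ]
    simp only [add_comm, add_left_comm]
  have hden : ∏ j ∈ (Finset.range (p + 1 + m + 1)).erase (p + 1), |(d (p + 1) : ℚ) - d j| =
      (∏ j ∈ Finset.range p, ((d (p + 1) : ℚ) - d (j + 1))) * d (p + 1) *
        ∏ k ∈ Finset.range m, ((d (p + 1 + (k + 1)) : ℚ) - d (p + 1)) := by
    have hsplit : (Finset.range (p + 1 + m + 1)).erase (p + 1) =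
        (Finset.range (p + 1)).disjUnion (Finset.Ico (p + 2) (p + 1 + m + 1))
          (Finset.disjoint_left.2 fun x => by simp; omega) := by
      ext x
      simp
      omega
    rw [hsplit, Finset.prod_disjUnion, Finset.prod_range_succ', Finset.prod_Ico_eq_prod_range,
      h0, Int.cast_zero, sub_zero, abs_of_pos hd, show p + 1 + m + 1 - (p + 2) = m by omega]
    congr 1
    · congr 1
      refine Finset.prod_congr rfl fun j hj => abs_of_nonneg ?_
      rw [Finset.mem_range] at hj
      have := sub_le_sub_of_lt_succ hmono (show j + 1 ≤ p + 1 by omega) (by omega)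
      have : 0 ≤ d (p + 1) - d (j + 1) := by push_cast at this; omega
      exact_mod_cast this
    · refine Finset.prod_congr rfl fun k hk => ?_
      rw [Finset.mem_range] at hk
      rw [abs_sub_comm, show p + 2 + k = p + 1 + (k + 1) by omega]
      refine abs_of_nonneg ?_
      have := sub_le_sub_of_lt_succ hmono (show p + 1 ≤ p + 1 + (k + 1) by omega) (by omega)
      have : 0 ≤ d (p + 1 + (k + 1)) - d (p + 1) := by push_cast at this; omega
      exact_mod_cast this
  rw [pureBetti, hnum, hden, ← mul_div_mul_comm, mul_right_comm, mul_right_comm _ (d (p + 1) : ℚ),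
    mul_div_mul_right _ _ hd.ne']

/-- The factors of the pure Betti number at indices below `i = p + 1`. -/
theorem prod_sub_le_prod_mul_pow (p a : ℕ) (x : ℕ → ℚ) (hx : ∀ j < p, (j : ℚ) + 1 ≤ x j)
    (hxa : ∀ j < p, x j ≤ (p : ℚ) + 1 + a) :
    ∏ j ∈ Finset.range p, ((p : ℚ) + 1 + a - x j) ≤
      (∏ j ∈ Finset.range p, x j) * ((p : ℚ) + 1) ^ a := by
  have hfac : ∏ j ∈ Finset.range p, ((j : ℚ) + 1) = p.factorial := by
    rw [← Finset.prod_range_add_one_eq_factorial]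
    push_cast
    rfl
  have hrefl : ∏ j ∈ Finset.range p, ((p : ℚ) + 1 + a - (j + 1)) =
      ∏ k ∈ Finset.range p, ((k : ℚ) + 1 + a) := by
    rw [← Finset.prod_range_reflect]
    refine Finset.prod_congr rfl fun j hj => ?_
    rw [Finset.mem_range] at hj
    rw [Nat.sub_sub, Nat.cast_sub (by omega)]
    push_cast
    ring
  have hpos : (0 : ℚ) < p.factorial := by positivity
  refine le_of_mul_le_mul_right ?_ hpos
  calc (∏ j ∈ Finset.range p, ((p : ℚ) + 1 + a - x j)) * p.factorial
      = ∏ j ∈ Finset.range p, (((p : ℚ) + 1 + a - x j) * (j + 1)) := by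
        rw [← hfac, Finset.prod_mul_distrib]
    _ ≤ ∏ j ∈ Finset.range p, (x j * ((p : ℚ) + 1 + a - (j + 1))) := by
        refine Finset.prod_le_prod (fun j hj => ?_) fun j hj => ?_
        · have := hxa j (Finset.mem_range.1 hj)
          exact mul_nonneg (by linarith) (by positivity)
        · have := hx j (Finset.mem_range.1 hj)
          have hp : (0 : ℚ) ≤ (p : ℚ) + 1 + a := by positivity
          nlinarith
    _ = (∏ j ∈ Finset.range p, x j) * ∏ k ∈ Finset.range p, ((k : ℚ) + 1 + a) := by
        rw [Finset.prod_mul_distrib, hrefl]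
    _ ≤ (∏ j ∈ Finset.range p, x j) * (p.factorial * ((p : ℚ) + 1) ^ a) := by
        refine mul_le_mul_of_nonneg_left (prod_range_add_le_factorial_mul_pow p a)
          (Finset.prod_nonneg fun j hj => ?_)
        have := hx j (Finset.mem_range.1 hj)
        have : (0 : ℚ) ≤ j := by positivity
        linarith
    _ = _ := by ring

/-- The factors of the pure Betti number at indices above `i`, where `d i = i + a`. -/
theorem choose_mul_prod_sub_le (i m a s : ℕ) (y : ℕ → ℚ)
    (hy : ∀ k < m, (i : ℚ) + a ≤ y k) (hys : ∀ k < m, y k ≤ (i : ℚ) + (k + 1) + (a + s)) :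
    ((i + m).choose i : ℚ) * ∏ k ∈ Finset.range m, (y k - ((i : ℚ) + a)) ≤
      (∏ k ∈ Finset.range m, y k) * ((m : ℚ) + 1) ^ s := by
  have hchoose : ((i + m).choose i : ℚ) * m.factorial =
      ∏ k ∈ Finset.range m, ((i : ℚ) + (k + 1)) := by
    have h := Nat.ascFactorial_eq_factorial_mul_choose i m
    rw [Nat.ascFactorial_eq_prod_range, mul_comm, ← Nat.choose_symm_add] at h
    rw [← Nat.cast_mul, ← h]
    push_cast
    exact Finset.prod_congr rfl fun k _ => by ring
  have hpos : (0 : ℚ) < m.factorial := by positivity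
  refine le_of_mul_le_mul_right ?_ hpos
  calc ((i + m).choose i : ℚ) * (∏ k ∈ Finset.range m, (y k - ((i : ℚ) + a))) * m.factorial
      = ∏ k ∈ Finset.range m, ((y k - ((i : ℚ) + a)) * ((i : ℚ) + (k + 1))) := by
        rw [Finset.prod_mul_distrib, ← hchoose]
        ring
    _ ≤ ∏ k ∈ Finset.range m, (y k * ((k : ℚ) + 1 + s)) := by
        refine Finset.prod_le_prod (fun k hk => ?_) fun k hk => ?_
        · have := hy k (Finset.mem_range.1 hk)
          exact mul_nonneg (by linarith) (by positivity)
        · have h1 := hy k (Finset.mem_range.1 hk)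
          have h2 := hys k (Finset.mem_range.1 hk)
          have hia : (0 : ℚ) ≤ (i : ℚ) + a := by positivity
          calc (y k - ((i : ℚ) + a)) * ((i : ℚ) + (k + 1))
              ≤ (y k - ((i : ℚ) + a)) * ((i : ℚ) + (k + 1) + (a + s)) := by
                refine mul_le_mul_of_nonneg_left ?_ (by linarith)
                have : (0 : ℚ) ≤ (a : ℚ) + s := by positivity
                linarith
            _ ≤ _ := by linarith [mul_le_mul_of_nonneg_left h2 hia]
    _ = (∏ k ∈ Finset.range m, y k) * ∏ k ∈ Finset.range m, ((k : ℚ) + 1 + s) :=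
        Finset.prod_mul_distrib
    _ ≤ (∏ k ∈ Finset.range m, y k) * (m.factorial * ((m : ℚ) + 1) ^ s) := by
        refine mul_le_mul_of_nonneg_left (prod_range_add_le_factorial_mul_pow m s)
          (Finset.prod_nonneg fun k hk => ?_)
        have := hy k (Finset.mem_range.1 hk)
        have : (0 : ℚ) ≤ (i : ℚ) + a := by positivity
        linarith
    _ = _ := by ring

/-- the sharper lower bound: for a degree sequence `d` with `d 0 = 0`,
`d N ≤ N + r`, and `a = d i − i`, we have
`β_i(π_d) ≥ binom(N,i) · i^(−a) · (N−i+1)^(−(r−a))`. -/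
theorem betti_sharp_lower (N r i : ℕ) (hN : 1 ≤ N) (hr : 1 ≤ r)
    (hi1 : 1 ≤ i) (hiN : i ≤ N)
    (d : ℕ → ℤ) (hmono : ∀ j < N, d j < d (j + 1))
    (h0 : d 0 = 0) (hdN : d N ≤ (N : ℤ) + r)
    (a : ℤ) (ha : a = d i - i) :
    (N.choose i : ℚ) * (i : ℚ) ^ (-a) * ((N : ℚ) - (i : ℚ) + 1) ^ (-((r : ℤ) - a))
      ≤ pureBetti N d i := by
  have ha0 : 0 ≤ a := by
    have := sub_le_sub_of_lt_succ hmono (Nat.zero_le i) hiN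
    push_cast at this
    omega
  have har : a ≤ r := by
    have := sub_le_sub_of_lt_succ hmono hiN le_rfl
    omega
  obtain ⟨s, hs⟩ := Int.eq_ofNat_of_zero_le (sub_nonneg.2 har)
  lift a to ℕ using ha0
  obtain ⟨p, rfl⟩ : ∃ p, i = p + 1 := ⟨i - 1, by omega⟩
  obtain ⟨m, rfl⟩ := Nat.exists_eq_add_of_le hiN
  have hdi : (d (p + 1) : ℚ) = (p : ℚ) + 1 + a := by
    have : d (p + 1) = (p : ℤ) + 1 + a := by push_cast at ha; omega
    exact_mod_cast this
  have hlow : ∀ j < p, 0 < (d (p + 1) : ℚ) - d (j + 1) := fun j hj => by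
    have := sub_le_sub_of_lt_succ hmono (show j + 1 ≤ p + 1 by omega) (by omega)
    have : 0 < d (p + 1) - d (j + 1) := by push_cast at this; omega
    exact_mod_cast this
  have hhigh : ∀ k < m, 0 < (d (p + 1 + (k + 1)) : ℚ) - d (p + 1) := fun k hk => by
    have := sub_le_sub_of_lt_succ hmono (show p + 1 ≤ p + 1 + (k + 1) by omega) (by omega)
    have : 0 < d (p + 1 + (k + 1)) - d (p + 1) := by push_cast at this; omega
    exact_mod_cast this
  have hA := prod_sub_le_prod_mul_pow p a (fun j => d (j + 1))
    (fun j hj => by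
      have := sub_le_sub_of_lt_succ hmono (Nat.zero_le (j + 1)) (by omega)
      have : (j : ℤ) + 1 ≤ d (j + 1) := by push_cast at this; omega
      exact_mod_cast this)
    (fun j hj => by have := hlow j hj; rw [← hdi]; linarith)
  have hB := choose_mul_prod_sub_le (p + 1) m a s (fun k => d (p + 1 + (k + 1)))
    (fun k hk => by have := hhigh k hk; push_cast; rw [← hdi]; linarith)
    (fun k hk => by
      have := sub_le_sub_of_lt_succ hmono (show p + 1 + (k + 1) ≤ p + 1 + m by omega) le_rfl
      have : d (p + 1 + (k + 1)) ≤ ((p + 1 : ℕ) : ℤ) + (k + 1) + (a + s) := by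
        push_cast at this hdN ⊢
        omega
      exact_mod_cast this)
  push_cast at hB
  rw [← hdi] at hA hB
  have hP := Finset.prod_pos fun j hj => hlow j (Finset.mem_range.1 hj)
  have hQ := Finset.prod_pos fun k hk => hhigh k (Finset.mem_range.1 hk)
  rw [pureBetti_eq_mul hmono h0, hs, mul_comm (Nat.cast _ : ℚ), mul_assoc]
  have hm : ((p + 1 + m : ℕ) : ℚ) - ((p + 1 : ℕ) : ℚ) + 1 = (m : ℚ) + 1 := by push_cast; ring
  have hbelow : ((p + 1 : ℕ) : ℚ) ^ (-(a : ℤ)) ≤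
      (∏ j ∈ Finset.range p, (d (j + 1) : ℚ)) /
        ∏ j ∈ Finset.range p, ((d (p + 1) : ℚ) - d (j + 1)) := by
    rw [le_div_iff₀ hP, zpow_neg, zpow_natCast, inv_mul_le_iff₀ (by positivity), mul_comm]
    push_cast
    exact hA
  have habove : ((p + 1 + m).choose (p + 1) : ℚ) * ((m : ℚ) + 1) ^ (-(s : ℤ)) ≤
      (∏ k ∈ Finset.range m, (d (p + 1 + (k + 1)) : ℚ)) /
        ∏ k ∈ Finset.range m, ((d (p + 1 + (k + 1)) : ℚ) - d (p + 1)) := by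
    rw [le_div_iff₀ hQ, zpow_neg, zpow_natCast, mul_right_comm, mul_inv_le_iff₀ (by positivity)]
    exact hB
  rw [hm]
  exact mul_le_mul hbelow habove (by positivity) (le_trans (by positivity) hbelow)
end
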